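/- Let T be convolution by Z(x) = e^{−|x|} on L²(ℝ), f, ψ₀ ∈ L²(ℝ), 0 < ε < 1/8, and define g_n = Tψ_n, ψ_{n+1} = ψ_n + 2εT*(f − g_n). Then ‖f − g_n‖_{L²} → 0 as n → ∞. -/

import Mathlib

open MeasureTheory Filter

open scoped ENNReal ContDiff InnerProductSpace

section Landweber

variable {E F : Type*} [NormedAddCommGroup E] [InnerProductSpace ℝ E]
  [NormedAddCommGroup F] [InnerProductSpace ℝ F]

/-- If `A` satisfies `‖A y‖² ≤ ⟪A y, y⟫` and has dense range, then `(1 - A)ⁿ → 0` strongly. -/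
theorem tendsto_one_sub_pow_apply (A : E →L[ℝ] E) (hA : ∀ y, ‖A y‖ ^ 2 ≤ ⟪A y, y⟫_ℝ)
    (hd : DenseRange A) (x : E) :
    Tendsto (fun n : ℕ => ((1 - A) ^ n) x) atTop (nhds 0) := by
  have hstep : ∀ y, ‖(1 - A) y‖ ^ 2 + ‖A y‖ ^ 2 ≤ ‖y‖ ^ 2 := by
    intro y
    have h : ‖y - A y‖ ^ 2 = ‖y‖ ^ 2 - 2 * ⟪y, A y⟫_ℝ + ‖A y‖ ^ 2 := norm_sub_sq_real y (A y)
    have h' := hA y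
    rw [real_inner_comm] at h'
    simp only [sub_apply, one_apply_eq_self]
    linarith
  have hpow : ∀ (n : ℕ) y, ((1 - A) ^ (n + 1)) y = (1 - A) (((1 - A) ^ n) y) := by
    intro n y
    rw [pow_succ']
    rfl
  have hsum : ∀ (n : ℕ) y, ‖((1 - A) ^ n) y‖ ^ 2
      + ∑ i ∈ Finset.range n, ‖A (((1 - A) ^ i) y)‖ ^ 2 ≤ ‖y‖ ^ 2 := by
    intro n y
    induction n with
    | zero => simp
    | succ n ih =>
      rw [Finset.sum_range_succ, hpow]
      linarith [hstep (((1 - A) ^ n) y)]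
  have hcontr : ∀ (n : ℕ) y, ‖((1 - A) ^ n) y‖ ≤ ‖y‖ := by
    intro n y
    have h0 : 0 ≤ ∑ i ∈ Finset.range n, ‖A (((1 - A) ^ i) y)‖ ^ 2 :=
      Finset.sum_nonneg fun i _ => by positivity
    exact le_of_sq_le_sq (by linarith [hsum n y]) (norm_nonneg y)
  have hcomm : ∀ (n : ℕ) y, ((1 - A) ^ n) (A y) = A (((1 - A) ^ n) y) := by
    intro n y
    have h : Commute ((1 - A) ^ n) A :=
      ((Commute.one_left A).sub_left (Commute.refl A)).pow_left n
    exact congrArg (fun B : E →L[ℝ] E => B y) h.eq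
  have hrange : ∀ y, Tendsto (fun n : ℕ => ‖((1 - A) ^ n) (A y)‖) atTop (nhds 0) := by
    intro y
    have hs : Summable fun i : ℕ => ‖A (((1 - A) ^ i) y)‖ ^ 2 := by
      refine summable_of_sum_range_le (c := ‖y‖ ^ 2) (fun i => by positivity) fun n => ?_
      linarith [hsum n y, sq_nonneg ‖((1 - A) ^ n) y‖]
    have h := hs.tendsto_atTop_zero.sqrt
    simpa [hcomm] using h
  rw [Metric.tendsto_atTop]
  intro δ hδ
  obtain ⟨y, hy⟩ := hd.exists_dist_lt x (half_pos hδ)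
  obtain ⟨N, hN⟩ := Metric.tendsto_atTop.1 (hrange y) _ (half_pos hδ)
  refine ⟨N, fun n hn => ?_⟩
  have h1 := hN n hn
  rw [Real.dist_0_eq_abs, abs_norm] at h1
  have h2 := hcontr n (x - A y)
  rw [dist_eq_norm] at hy
  rw [dist_zero_right]
  have h3 : ((1 - A) ^ n) x = ((1 - A) ^ n) (x - A y) + ((1 - A) ^ n) (A y) := by
    rw [← map_add, sub_add_cancel]
  rw [h3]
  linarith [norm_add_le (((1 - A) ^ n) (x - A y)) (((1 - A) ^ n) (A y))]

/-- Landweber iteration for an operator with dense range and a small enough step size drives the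
residual to zero. -/
theorem tendsto_norm_landweber_residual [CompleteSpace E] [CompleteSpace F] (T : E →L[ℝ] F)
    (hd : DenseRange T) {s : ℝ} (hs0 : 0 < s) (hs : s * ‖T‖ ^ 2 ≤ 1) (f : F) (ψ : ℕ → E)
    (hψ : ∀ n, ψ (n + 1) = ψ n + s • T.adjoint (f - T (ψ n))) :
    Tendsto (fun n => ‖f - T (ψ n)‖) atTop (nhds 0) := by
  let A : F →L[ℝ] F := s • (T ∘L T.adjoint)
  have hAapp : ∀ y, A y = s • T (T.adjoint y) := fun y => rfl
  have hinner : ∀ y, ⟪A y, y⟫_ℝ = s * ‖T.adjoint y‖ ^ 2 := by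
    intro y
    rw [hAapp, real_inner_smul_left, ← ContinuousLinearMap.adjoint_inner_right,
      real_inner_self_eq_norm_sq]
  have hA : ∀ y, ‖A y‖ ^ 2 ≤ ⟪A y, y⟫_ℝ := by
    intro y
    rw [hinner, hAapp, norm_smul, Real.norm_of_nonneg hs0.le]
    calc (s * ‖T (T.adjoint y)‖) ^ 2 ≤ (s * (‖T‖ * ‖T.adjoint y‖)) ^ 2 := by
          gcongr
          exact T.le_opNorm _
      _ = (s * ‖T‖ ^ 2) * (s * ‖T.adjoint y‖ ^ 2) := by ring
      _ ≤ 1 * (s * ‖T.adjoint y‖ ^ 2) := by gcongr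
      _ = _ := one_mul _
  have hker : ∀ y, T.adjoint y = 0 → y = 0 := by
    intro y hy
    refine hd.eq_zero_of_inner_left ℝ ?_
    intro x
    rw [← ContinuousLinearMap.adjoint_inner_left, hy, inner_zero_left]
  have hdA : DenseRange A := by
    have htop : (A.range).topologicalClosure = ⊤ := by
      rw [Submodule.topologicalClosure_eq_top_iff, Submodule.eq_bot_iff]
      intro y hy
      have h0 : ⟪A y, y⟫_ℝ = 0 := (Submodule.mem_orthogonal _ _).1 hy _ ⟨y, rfl⟩
      rw [hinner] at h0
      refine hker y ?_
      simpa [hs0.ne'] using h0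
    exact Submodule.dense_iff_topologicalClosure_eq_top.2 htop
  have hres : ∀ n, f - T (ψ n) = ((1 - A) ^ n) (f - T (ψ 0)) := by
    intro n
    induction n with
    | zero => simp
    | succ n ih =>
      rw [pow_succ']
      change _ = (1 - A) (((1 - A) ^ n) (f - T (ψ 0)))
      rw [← ih, hψ]
      simp only [sub_apply, one_apply_eq_self, hAapp, map_add,
        map_smul]
      abel
  have h := (tendsto_one_sub_pow_apply A hA hdA (f - T (ψ 0))).norm
  rw [norm_zero] at h
  exact h.congr fun n => by rw [← hres n]

end Landweber

section ExpKernel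

theorem integral_exp_neg_abs : ∫ x : ℝ, Real.exp (-|x|) = 2 := by
  rw [integral_comp_abs (f := fun x => Real.exp (-x)), integral_exp_neg_Ioi_zero, mul_one]

theorem integrable_exp_neg_abs : Integrable fun x : ℝ => Real.exp (-|x|) :=
  Integrable.of_integral_ne_zero (by rw [integral_exp_neg_abs]; norm_num)

theorem lintegral_exp_neg_abs : ∫⁻ x : ℝ, ENNReal.ofReal (Real.exp (-|x|)) = 2 := by
  rw [← ofReal_integral_eq_lintegral_ofReal integrable_exp_neg_abs
    (ae_of_all _ fun x => (Real.exp_pos _).le), integral_exp_neg_abs]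
  norm_num

/-- Cauchy-Schwarz with respect to the weight `k`. -/
theorem sq_lintegral_mul_le {α : Type*} [MeasurableSpace α] {μ : Measure α} {k g : α → ℝ≥0∞}
    (hk : AEMeasurable k μ) (hg : AEMeasurable g μ) :
    (∫⁻ a, k a * g a ∂μ) ^ 2 ≤ (∫⁻ a, k a ∂μ) * ∫⁻ a, k a * g a ^ 2 ∂μ := by
  have hhalf : ∀ t : ℝ≥0∞, (t ^ (1 / 2 : ℝ)) ^ 2 = t := by
    intro t
    rw [← ENNReal.rpow_natCast, ← ENNReal.rpow_mul]
    norm_num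
  have h := ENNReal.lintegral_mul_le_Lp_mul_Lq μ Real.HolderConjugate.two_two
    (hk.pow_const (1 / 2 : ℝ)) ((hk.pow_const (1 / 2 : ℝ)).mul hg)
  simp only [Pi.mul_apply, ENNReal.rpow_two, mul_pow, hhalf, ← mul_assoc, ← pow_two] at h
  calc _ ≤ _ := pow_le_pow_left' h 2
    _ = _ := by rw [mul_pow, hhalf, hhalf]

/-- Young's inequality for convolution with `exp (-|x|)` on square integrable functions. -/
theorem lintegral_sq_exp_neg_abs_conv_le {g : ℝ → ℝ} (hg : AEStronglyMeasurable g volume) :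
    ∫⁻ x, ‖∫ y, Real.exp (-|x - y|) * g y‖ₑ ^ 2 ≤ 4 * ∫⁻ y, ‖g y‖ₑ ^ 2 := by
  let k : ℝ → ℝ → ℝ≥0∞ := fun x y => ENNReal.ofReal (Real.exp (-|x - y|))
  have hk : Measurable (Function.uncurry k) := by
    unfold Function.uncurry
    fun_prop
  have hkx : ∀ x, ∫⁻ y, k x y = 2 := fun x => by
    rw [← lintegral_exp_neg_abs]
    exact lintegral_sub_left_eq_self (fun z => ENNReal.ofReal (Real.exp (-|z|))) x
  have hky : ∀ y, ∫⁻ x, k x y = 2 := fun y => by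
    rw [← lintegral_exp_neg_abs]
    exact lintegral_sub_right_eq_self (fun z => ENNReal.ofReal (Real.exp (-|z|))) y
  have hpt : ∀ x, ‖∫ y, Real.exp (-|x - y|) * g y‖ₑ ^ 2 ≤ 2 * ∫⁻ y, k x y * ‖g y‖ₑ ^ 2 := by
    intro x
    have h1 : ‖∫ y, Real.exp (-|x - y|) * g y‖ₑ ≤ ∫⁻ y, k x y * ‖g y‖ₑ := by
      refine (enorm_integral_le_lintegral_enorm _).trans_eq (lintegral_congr fun y => ?_)
      rw [enorm_mul, Real.enorm_of_nonneg (Real.exp_pos _).le]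
    refine (pow_le_pow_left' h1 2).trans ?_
    rw [← hkx x]
    exact sq_lintegral_mul_le (hk.comp measurable_prodMk_left).aemeasurable hg.enorm
  calc _ ≤ ∫⁻ x, 2 * ∫⁻ y, k x y * ‖g y‖ₑ ^ 2 := lintegral_mono hpt
    _ = 2 * ∫⁻ x, ∫⁻ y, k x y * ‖g y‖ₑ ^ 2 := lintegral_const_mul' _ _ (by norm_num)
    _ = 2 * ∫⁻ y, ∫⁻ x, k x y * ‖g y‖ₑ ^ 2 := by
      rw [lintegral_lintegral_swap]
      exact hk.aemeasurable.mul ((hg.enorm.pow_const 2).comp_snd)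
    _ = 2 * ∫⁻ y, 2 * ‖g y‖ₑ ^ 2 := by
      congr 1
      refine lintegral_congr fun y => ?_
      rw [lintegral_mul_const' _ _ (by simp), hky]
    _ = _ := by
      rw [lintegral_const_mul' _ _ (by norm_num), ← mul_assoc]
      norm_num

/-- `exp (-|x|) / 2` is the fundamental solution of `1 - d²/dx²`. -/
theorem integral_exp_neg_abs_mul_sub_deriv_deriv {u : ℝ → ℝ} (hu : ContDiff ℝ ∞ u)
    (hc : HasCompactSupport u) (x : ℝ) :
    ∫ y, Real.exp (-|x - y|) * (u y - deriv (deriv u) y) = 2 * u x := by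
  have hu1 : ContDiff ℝ ∞ (deriv u) := (contDiff_infty_iff_deriv.1 hu).2
  have hu2 : ContDiff ℝ ∞ (deriv (deriv u)) := (contDiff_infty_iff_deriv.1 hu1).2
  have hd : ∀ y, HasDerivAt u (deriv u y) y := fun y =>
    ((contDiff_infty_iff_deriv.1 hu).1 y).hasDerivAt
  have hd1 : ∀ y, HasDerivAt (deriv u) (deriv (deriv u) y) y := fun y =>
    ((contDiff_infty_iff_deriv.1 hu1).1 y).hasDerivAt
  have hint : Integrable fun y => Real.exp (-|x - y|) * (u y - deriv (deriv u) y) := by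
    refine Continuous.integrable_of_hasCompactSupport ?_ (hc.sub hc.deriv.deriv).mul_left
    have := hu.continuous
    have := hu2.continuous
    fun_prop
  let v : ℝ → ℝ := fun y => Real.exp (y - x) * (u y - deriv u y)
  let w : ℝ → ℝ := fun y => Real.exp (x - y) * (u y + deriv u y)
  have hv : ContDiff ℝ 1 v := by
    have h0 := hu.of_le (m := 1) (by simp)
    have h1 := hu1.of_le (m := 1) (by simp)
    fun_prop
  have hw : ContDiff ℝ 1 w := by
    have h0 := hu.of_le (m := 1) (by simp)
    have h1 := hu1.of_le (m := 1) (by simp)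
    fun_prop
  have hvc : HasCompactSupport v := (hc.sub hc.deriv).mul_left
  have hwc : HasCompactSupport w := (hc.add hc.deriv).mul_left
  have hv' : ∀ y, deriv v y = Real.exp (y - x) * (u y - deriv (deriv u) y) := by
    intro y
    have h := (((hasDerivAt_id y).sub_const x).exp.mul ((hd y).sub (hd1 y))).deriv
    refine h.trans ?_
    simp only [id, Pi.sub_apply]
    ring
  have hw' : ∀ y, deriv w y = -(Real.exp (x - y) * (u y - deriv (deriv u) y)) := by
    intro y
    have h := (((hasDerivAt_id y).const_sub x).exp.mul ((hd y).add (hd1 y))).deriv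
    refine h.trans ?_
    simp only [id, Pi.add_apply]
    ring
  have hI : ∫ y in Set.Iic x, Real.exp (-|x - y|) * (u y - deriv (deriv u) y) = v x := by
    rw [← hvc.integral_Iic_deriv_eq hv x]
    refine setIntegral_congr_fun measurableSet_Iic fun y hy => ?_
    simp only [hv', abs_of_nonneg (sub_nonneg.2 (Set.mem_Iic.1 hy)), neg_sub]
  have hJ : ∫ y in Set.Ioi x, Real.exp (-|x - y|) * (u y - deriv (deriv u) y) = w x := by
    rw [← neg_neg (w x), ← hwc.integral_Ioi_deriv_eq hw x, ← integral_neg]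
    refine setIntegral_congr_fun measurableSet_Ioi fun y hy => ?_
    simp only [hw', abs_of_neg (sub_neg.2 (Set.mem_Ioi.1 hy)), neg_neg]
  rw [← intervalIntegral.integral_Iic_add_Ioi hint.integrableOn hint.integrableOn, hI, hJ]
  simp only [v, w, sub_self, Real.exp_zero]
  ring

/-- Convolution with `exp (-|x|)` has operator norm at most `‖exp (-|x|)‖₁ = 2`. -/
theorem norm_exp_neg_abs_conv_le
    (T : Lp ℝ 2 (volume : Measure ℝ) →L[ℝ] Lp ℝ 2 (volume : Measure ℝ))
    (hT : ∀ φ : Lp ℝ 2 (volume : Measure ℝ),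
      (T φ : ℝ → ℝ) =ᵐ[volume] fun x => ∫ y : ℝ, Real.exp (-|x - y|) * φ y) :
    ‖T‖ ≤ 2 := by
  have hsq : ∀ φ : Lp ℝ 2 (volume : Measure ℝ), ‖φ‖ₑ ^ 2 = ∫⁻ x, ‖φ x‖ₑ ^ 2 := by
    intro φ
    rw [Lp.enorm_def, eLpNorm_eq_lintegral_rpow_enorm_toReal (by simp) (by simp),
      ← ENNReal.rpow_two, ← ENNReal.rpow_mul]
    simp
  refine T.opNorm_le_bound (by norm_num) fun φ => ?_
  have h : ‖T φ‖ₑ ^ 2 ≤ (2 * ‖φ‖ₑ) ^ 2 := by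
    rw [mul_pow, hsq, hsq]
    calc _ = ∫⁻ x, ‖∫ y, Real.exp (-|x - y|) * φ y‖ₑ ^ 2 := by
          refine lintegral_congr_ae ?_
          filter_upwards [hT φ] with x hx
          rw [hx]
      _ ≤ 4 * ∫⁻ y, ‖φ y‖ₑ ^ 2 := lintegral_sq_exp_neg_abs_conv_le (Lp.aestronglyMeasurable φ)
      _ = _ := by norm_num
  have h2 : ‖T φ‖ₑ ≤ 2 * ‖φ‖ₑ := (ENNReal.pow_le_pow_left_iff two_ne_zero).1 h
  have h3 := ENNReal.toReal_mono (by finiteness) h2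
  simpa using h3

theorem denseRange_exp_neg_abs_conv
    (T : Lp ℝ 2 (volume : Measure ℝ) →L[ℝ] Lp ℝ 2 (volume : Measure ℝ))
    (hT : ∀ φ : Lp ℝ 2 (volume : Measure ℝ),
      (T φ : ℝ → ℝ) =ᵐ[volume] fun x => ∫ y : ℝ, Real.exp (-|x - y|) * φ y) :
    DenseRange T := by
  refine (Lp.dense_hasCompactSupport_contDiff (F := ℝ) (E := ℝ) (μ := volume) (p := 2)
    (by simp)).mono ?_
  rintro φ ⟨u, hφ, hc, hu⟩
  have hu1 : ContDiff ℝ ∞ (deriv u) := (contDiff_infty_iff_deriv.1 hu).2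
  have hu2 : ContDiff ℝ ∞ (deriv (deriv u)) := (contDiff_infty_iff_deriv.1 hu1).2
  have hm : MemLp (fun y => u y - deriv (deriv u) y) 2 (volume : Measure ℝ) :=
    (hu.continuous.sub hu2.continuous).memLp_of_hasCompactSupport (hc.sub hc.deriv.deriv)
  refine ⟨(1 / 2 : ℝ) • hm.toLp, ?_⟩
  rw [map_smul]
  refine Lp.ext ?_
  filter_upwards [hφ, hT hm.toLp, Lp.coeFn_smul (1 / 2 : ℝ) (T hm.toLp)] with x h1 h2 h3
  have h4 : ∫ y, Real.exp (-|x - y|) * hm.toLp _ y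
      = ∫ y, Real.exp (-|x - y|) * (u y - deriv (deriv u) y) := by
    refine integral_congr_ae ?_
    filter_upwards [hm.coeFn_toLp] with y hy
    rw [hy]
  rw [h3, Pi.smul_apply, h2, h4, integral_exp_neg_abs_mul_sub_deriv_deriv hu hc, h1, smul_eq_mul]
  ring

end ExpKernel

/-- Gradient descent with the FReX activation on `L²(ℝ)` converges:
`‖f − g_n‖ → 0` where `g_n = Tψ_n`, `ψ_{n+1} = ψ_n + 2εT*(f − g_n)` and `T`
is convolution with `Z(x) = e^{−|x|}`. -/
theorem stmt_16
    (T : Lp ℝ 2 (volume : Measure ℝ) →L[ℝ] Lp ℝ 2 (volume : Measure ℝ))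
    (hT : ∀ φ : Lp ℝ 2 (volume : Measure ℝ),
      (T φ : ℝ → ℝ) =ᵐ[volume] fun x => ∫ y : ℝ, Real.exp (-|x - y|) * φ y)
    (f : Lp ℝ 2 (volume : Measure ℝ))
    (ε : ℝ) (hε0 : 0 < ε) (hε : ε < 1 / 8)
    (ψ : ℕ → Lp ℝ 2 (volume : Measure ℝ))
    (hiter : ∀ n : ℕ, ψ (n + 1) = ψ n + (2 * ε) • T.adjoint (f - T (ψ n))) :
    Tendsto (fun n : ℕ => ‖f - T (ψ n)‖) atTop (nhds 0) := by
  refine tendsto_norm_landweber_residual T (denseRange_exp_neg_abs_conv T hT)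
    (by positivity : 0 < 2 * ε) ?_ f ψ hiter
  calc 2 * ε * ‖T‖ ^ 2 ≤ 2 * ε * 2 ^ 2 := by
        gcongr
        exact norm_exp_neg_abs_conv_le T hT
    _ ≤ 1 := by linarith
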